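/- arXiv:2306.04252 — 4 statements merged into one kernel-verified Lean document; each statement's English description precedes it below -/
import Mathlib

section
/- Let E be a real normed vector space, A ⊆ E, S : A → E η'-Hölder with constant C' (0 < η' ≤ 1, C' > 0), T : E → E η-Hölder with constant C on S(A) (0 < η ≤ 1, C > 0), and define v : A → E by v(a) = T(S(a)) − S(a). Let ε ≥ 0 and let r : A → E satisfy ‖r(a) − v(a)‖ ≤ ε/2 for all a ∈ A. Then for all a, b ∈ A: ‖r(a) − r(b)‖ ≤ ε + C'‖a − b‖^{η'} + C · C'^{η} · ‖a − b‖^{η·η'}. -/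
/-- Inequality (r-reg-1): if `r` is a uniform ε/2-approximation on `A` of the
velocity field `v = (T - id) ∘ S`, with `S` η'-Hölder on `A` and `T` η-Hölder on
`S '' A`, then `r` satisfies the stated Hölder-type bound up to the error ε. -/
theorem residual_block_holder_estimate
    {E : Type*} [NormedAddCommGroup E] [NormedSpace ℝ E]
    (A : Set E) (S T v r : E → E) (η η' C C' ε : ℝ)
    (hη : 0 < η) (hη1 : η ≤ 1) (hη' : 0 < η') (hη'1 : η' ≤ 1)
    (hC : 0 < C) (hC' : 0 < C') (hε : 0 ≤ ε)
    (hS : ∀ a ∈ A, ∀ b ∈ A, ‖S a - S b‖ ≤ C' * ‖a - b‖ ^ η')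
    (hT : ∀ x ∈ S '' A, ∀ y ∈ S '' A, ‖T x - T y‖ ≤ C * ‖x - y‖ ^ η)
    (hv : ∀ a ∈ A, v a = T (S a) - S a)
    (hr : ∀ a ∈ A, ‖r a - v a‖ ≤ ε / 2) :
    ∀ a ∈ A, ∀ b ∈ A,
      ‖r a - r b‖ ≤ ε + C' * ‖a - b‖ ^ η' + C * C' ^ η * ‖a - b‖ ^ (η * η') := by
  intro a ha b hb
  have h1 := hr a ha
  have h2 := hr b hb
  have h3 := hS a ha b hb
  have h4 := hT (S a) ⟨a, ha, rfl⟩ (S b) ⟨b, hb, rfl⟩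
  have h5 : ‖S a - S b‖ ^ η ≤ C' ^ η * ‖a - b‖ ^ (η * η') := by
    calc ‖S a - S b‖ ^ η ≤ (C' * ‖a - b‖ ^ η') ^ η :=
          Real.rpow_le_rpow (norm_nonneg _) h3 hη.le
      _ = C' ^ η * ‖a - b‖ ^ (η * η') := by
          rw [Real.mul_rpow hC'.le (by positivity), ← Real.rpow_mul (norm_nonneg _), mul_comm η' η]
  have h6 := mul_le_mul_of_nonneg_left h5 hC.le
  have h7 : r a - r b = ((r a - v a) - (r b - v b)) + ((T (S a) - T (S b)) - (S a - S b)) := by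
    rw [hv a ha, hv b hb]; abel
  have h8 := norm_add_le ((r a - v a) - (r b - v b)) ((T (S a) - T (S b)) - (S a - S b))
  have h9 := norm_sub_le (r a - v a) (r b - v b)
  have h10 := norm_sub_le (T (S a) - T (S b)) (S a - S b)
  rw [h7]
  linarith
end

section
/- Let E be a real normed vector space and M ≥ 1 a natural number. For each m with 0 ≤ m < M, let A_m ⊆ E, let S_m : A_m → E be η_m-Hölder with constant C_m (0 < η_m ≤ 1, C_m > 0), let T : E → E be η-Hölder with constant C on the union of the images S_m(A_m) (0 < η ≤ 1, C > 0), define v_m : A_m → E by v_m(a) = T(S_m(a)) − S_m(a), let ε ≥ 0, and let r_m : A_m → E satisfy ‖r_m(a) − v_m(a)‖ ≤ ε/2 for all a ∈ A_m. Set K = max_{0 ≤ m < M} (C_m + C·C_m^η), ζ₁ = η · min_{0 ≤ m < M} η_m, and ζ₂ = max_{0 ≤ m < M} η_m. Then 0 < ζ₁ ≤ ζ₂ ≤ 1, and for every m and all a, b ∈ A_m: ‖r_m(a) − r_m(b)‖ ≤ ε + K‖a − b‖^{ζ₁} if ‖a − b‖ ≤ 1, and ‖r_m(a) − r_m(b)‖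 ≤ ε + K‖a − b‖^{ζ₂} if ‖a − b‖ > 1. -/
/-- Theorem 1 of the paper, stated abstractly: the residual blocks `r m`,
being uniform ε/2-approximations of the velocity fields
`v m = (T - id) ∘ S m`, satisfy a uniform Hölder-type estimate on the supports
`A m`, with exponent ζ₁ for small distances and ζ₂ for large distances. -/
theorem residual_blocks_uniform_holder_estimate
    {E : Type*} [NormedAddCommGroup E] [NormedSpace ℝ E]
    (M : ℕ) (hM : 1 ≤ M)
    (A : ℕ → Set E) (S : ℕ → E → E) (T : E → E) (v r : ℕ → E → E)
    (ηm Cm : ℕ → ℝ) (η C ε : ℝ)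
    (hηm : ∀ m < M, 0 < ηm m) (hηm1 : ∀ m < M, ηm m ≤ 1)
    (hCm : ∀ m < M, 0 < Cm m)
    (hη : 0 < η) (hη1 : η ≤ 1) (hC : 0 < C) (hε : 0 ≤ ε)
    (hS : ∀ m < M, ∀ a ∈ A m, ∀ b ∈ A m, ‖S m a - S m b‖ ≤ Cm m * ‖a - b‖ ^ ηm m)
    (hT : ∀ x ∈ ⋃ m ∈ Finset.range M, S m '' A m,
          ∀ y ∈ ⋃ m ∈ Finset.range M, S m '' A m, ‖T x - T y‖ ≤ C * ‖x - y‖ ^ η)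
    (hv : ∀ m < M, ∀ a ∈ A m, v m a = T (S m a) - S m a)
    (hr : ∀ m < M, ∀ a ∈ A m, ‖r m a - v m a‖ ≤ ε / 2)
    (K ζ₁ ζ₂ : ℝ)
    (hK : K = (Finset.range M).sup' (Finset.nonempty_range_iff.mpr (by omega))
            (fun m => Cm m + C * Cm m ^ η))
    (hζ₁ : ζ₁ = η * (Finset.range M).inf' (Finset.nonempty_range_iff.mpr (by omega)) ηm)
    (hζ₂ : ζ₂ = (Finset.range M).sup' (Finset.nonempty_range_iff.mpr (by omega)) ηm) :
    (0 < ζ₁ ∧ ζ₁ ≤ ζ₂ ∧ ζ₂ ≤ 1) ∧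
    ∀ m < M, ∀ a ∈ A m, ∀ b ∈ A m,
      (‖a - b‖ ≤ 1 → ‖r m a - r m b‖ ≤ ε + K * ‖a - b‖ ^ ζ₁) ∧
      (1 < ‖a - b‖ → ‖r m a - r m b‖ ≤ ε + K * ‖a - b‖ ^ ζ₂) := by
  have hne : (Finset.range M).Nonempty := Finset.nonempty_range_iff.mpr (by omega)
  have hinf : ∀ m < M, (Finset.range M).inf' hne ηm ≤ ηm m := fun m hm =>
    Finset.inf'_le _ (Finset.mem_range.mpr hm)
  have hsup : ∀ m < M, ηm m ≤ ζ₂ := fun m hm => by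
    rw [hζ₂]; exact Finset.le_sup' _ (Finset.mem_range.mpr hm)
  have hKm : ∀ m < M, Cm m + C * Cm m ^ η ≤ K := fun m hm => by
    rw [hK]
    exact Finset.le_sup' (fun m => Cm m + C * Cm m ^ η) (Finset.mem_range.mpr hm)
  have hinf0 : 0 < (Finset.range M).inf' hne ηm := by
    rw [Finset.lt_inf'_iff]
    intro m hm
    exact hηm m (Finset.mem_range.mp hm)
  have hζ₁0 : 0 < ζ₁ := by rw [hζ₁]; exact mul_pos hη hinf0
  have hζ₁m : ∀ m < M, ζ₁ ≤ ηm m * η := fun m hm => by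
    rw [hζ₁, mul_comm]
    exact mul_le_mul_of_nonneg_right (hinf m hm) hη.le
  have hmm : ∀ m < M, ηm m * η ≤ ηm m := fun m hm =>
    mul_le_of_le_one_right (hηm m hm).le hη1
  refine ⟨⟨hζ₁0, ?_, ?_⟩, ?_⟩
  · have h0 : 0 < M := hM
    exact ((hζ₁m 0 h0).trans (hmm 0 h0)).trans (hsup 0 h0)
  · rw [hζ₂]
    exact Finset.sup'_le _ _ fun m hm => hηm1 m (Finset.mem_range.mp hm)
  intro m hm a ha b hb
  have hd : 0 ≤ ‖a - b‖ := norm_nonneg _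
  have hc := hCm m hm
  have hmem : ∀ x ∈ A m, S m x ∈ ⋃ m ∈ Finset.range M, S m '' A m := fun x hx =>
    Set.mem_biUnion (Finset.mem_coe.mpr (Finset.mem_range.mpr hm)) (Set.mem_image_of_mem _ hx)
  have h1 := hS m hm a ha b hb
  have h2 : ‖T (S m a) - T (S m b)‖ ≤ C * Cm m ^ η * ‖a - b‖ ^ (ηm m * η) := by
    calc _ ≤ C * ‖S m a - S m b‖ ^ η := hT _ (hmem a ha) _ (hmem b hb)
      _ ≤ C * (Cm m * ‖a - b‖ ^ ηm m) ^ η := by gcongr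
      _ = _ := by
        rw [Real.mul_rpow hc.le (Real.rpow_nonneg hd _), Real.rpow_mul hd, mul_assoc]
  have h3 : ‖r m a - r m b‖ ≤ ε + (Cm m * ‖a - b‖ ^ ηm m
      + C * Cm m ^ η * ‖a - b‖ ^ (ηm m * η)) := by
    have e : r m a - r m b = (r m a - v m a) - (r m b - v m b)
        + ((T (S m a) - T (S m b)) - (S m a - S m b)) := by
      rw [hv m hm a ha, hv m hm b hb]; abel
    rw [e]
    have n1 := norm_add_le ((r m a - v m a) - (r m b - v m b))
      ((T (S m a) - T (S m b)) - (S m a - S m b))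
    have n2 := norm_sub_le (r m a - v m a) (r m b - v m b)
    have n3 := norm_sub_le (T (S m a) - T (S m b)) (S m a - S m b)
    have n4 := hr m hm a ha
    have n5 := hr m hm b hb
    linarith
  have hcc : 0 ≤ C * Cm m ^ η := by positivity
  have key : ∀ z : ℝ, ‖a - b‖ ^ ηm m ≤ ‖a - b‖ ^ z → ‖a - b‖ ^ (ηm m * η) ≤ ‖a - b‖ ^ z →
      ‖r m a - r m b‖ ≤ ε + K * ‖a - b‖ ^ z := by
    intro z k1 k2
    have k3 := mul_le_mul_of_nonneg_left k1 hc.le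
    have k4 := mul_le_mul_of_nonneg_left k2 hcc
    have k5 := mul_le_mul_of_nonneg_right (hKm m hm) (Real.rpow_nonneg hd z)
    linarith
  constructor
  · intro hle
    exact key _
      (Real.rpow_le_rpow_of_exponent_ge' hd hle hζ₁0.le ((hζ₁m m hm).trans (hmm m hm)))
      (Real.rpow_le_rpow_of_exponent_ge' hd hle hζ₁0.le (hζ₁m m hm))
  · intro hlt
    exact key _ (Real.rpow_le_rpow_of_exponent_le hlt.le (hsup m hm))
      (Real.rpow_le_rpow_of_exponent_le hlt.le ((hmm m hm).trans (hsup m hm)))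
end

section
/- Let E be a real normed vector space, t₀ < t₁ < ⋯ < t_N a subdivision with step sizes h_n = t_{n+1} − t_n and T = t_N − t₀, and let φ : ℝ × E × ℝ → E satisfy ‖φ(t, x, h) − φ(t, y, h)‖ ≤ L‖x − y‖ for all t, h ∈ ℝ and x, y ∈ E (L > 0). Let (x_n)_{0 ≤ n ≤ N} and (x̃_n)_{0 ≤ n ≤ N} be sequences in E and (ε_n)_{0 ≤ n < N} a sequence in E such that x_{n+1} = x_n + h_n φ(t_n, x_n, h_n) and x̃_{n+1} = x̃_n + h_n φ(t_n, x̃_n, h_n) + h_n ε_n for all 0 ≤ n < N. Then max_{0 ≤ n ≤ N} ‖x̃_n − x_n‖ ≤ e^{L T} (‖x̃₀ − x₀‖ + T · max_{0 ≤ n < N} ‖ε_n‖). -/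
/-- Zero-stability criterion: a one-step method whose increment function is
uniformly L-Lipschitz in its second variable is zero-stable with constant
`exp (L * T)`. -/
theorem zero_stability_criterion
    {E : Type*} [NormedAddCommGroup E] [NormedSpace ℝ E]
    (N : ℕ) (hN : 0 < N) (t : ℕ → ℝ)
    (ht : ∀ n < N, t n < t (n + 1))
    (h : ℕ → ℝ) (hh : ∀ n, h n = t (n + 1) - t n)
    (T : ℝ) (hT : T = t N - t 0)
    (φ : ℝ × E × ℝ → E) (L : ℝ) (hL : 0 < L)
    (hφ : ∀ (s hs : ℝ) (x y : E), ‖φ (s, x, hs) - φ (s, y, hs)‖ ≤ L * ‖x - y‖)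
    (x xt : ℕ → E) (ε : ℕ → E)
    (hx : ∀ n < N, x (n + 1) = x n + h n • φ (t n, x n, h n))
    (hxt : ∀ n < N, xt (n + 1) = xt n + h n • φ (t n, xt n, h n) + h n • ε n) :
    ∀ n ≤ N, ‖xt n - x n‖ ≤
      Real.exp (L * T) * (‖xt 0 - x 0‖ +
        T * ((Finset.range N).sup' (Finset.nonempty_range_iff.mpr (by omega))
              fun n => ‖ε n‖)) := by
  have hM : ∀ n < N, ‖ε n‖ ≤ (Finset.range N).sup'
      (Finset.nonempty_range_iff.mpr (by omega)) fun n => ‖ε n‖ := fun n hn =>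
    Finset.le_sup' (fun n => ‖ε n‖) (Finset.mem_range.mpr hn)
  generalize (Finset.range N).sup'
      (Finset.nonempty_range_iff.mpr (by omega)) (fun n => ‖ε n‖) = M at hM ⊢
  have hM0 : 0 ≤ M := (norm_nonneg _).trans (hM 0 hN)
  have hmono : ∀ n k, n + k ≤ N → t n ≤ t (n + k) := by
    intro n k
    induction k with
    | zero => intro _; exact le_rfl
    | succ k ih =>
      intro hk
      exact (ih (by omega)).trans (ht (n + k) (by omega)).le
  have key : ∀ n ≤ N, ‖xt n - x n‖ ≤
      Real.exp (L * (t n - t 0)) * (‖xt 0 - x 0‖ + (t n - t 0) * M) := by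
    intro n
    induction n with
    | zero => intro _; simp
    | succ n ih =>
      intro hn
      have hnN : n < N := by omega
      have ih := ih hnN.le
      have hpos : 0 < h n := by rw [hh]; linarith [ht n hnN]
      have hτ : 0 ≤ t n - t 0 := by
        have := hmono 0 n (by omega)
        rw [Nat.zero_add] at this
        linarith
      have heq : xt (n + 1) - x (n + 1) = (xt n - x n)
          + h n • (φ (t n, xt n, h n) - φ (t n, x n, h n)) + h n • ε n := by
        rw [hx n hnN, hxt n hnN, smul_sub]; abel
      have h1 : ‖xt (n + 1) - x (n + 1)‖ ≤
          ‖xt n - x n‖ + h n * (L * ‖xt n - x n‖) + h n * M := by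
        rw [heq]
        refine (norm_add₃_le).trans ?_
        rw [norm_smul, norm_smul, Real.norm_of_nonneg hpos.le]
        gcongr
        · exact hφ _ _ _ _
        · exact hM n hnN
      have ht' : t (n + 1) - t 0 = (t n - t 0) + h n := by rw [hh]; ring
      rw [ht']
      generalize t n - t 0 = τ at *
      have hE : 1 + L * h n ≤ Real.exp (L * h n) := by
        linarith [Real.add_one_le_exp (L * h n)]
      have hE1 : 1 ≤ Real.exp (L * (τ + h n)) := Real.one_le_exp (by positivity)
      calc ‖xt (n + 1) - x (n + 1)‖
          ≤ (1 + L * h n) * ‖xt n - x n‖ + 1 * (h n * M) := by linarith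
        _ ≤ Real.exp (L * h n) * (Real.exp (L * τ) * (‖xt 0 - x 0‖ + τ * M))
            + Real.exp (L * (τ + h n)) * (h n * M) := by gcongr
        _ = Real.exp (L * (τ + h n)) * (‖xt 0 - x 0‖ + (τ + h n) * M) := by
          rw [mul_add L, Real.exp_add]; ring
  intro n hn
  refine (key n hn).trans ?_
  have hτ : 0 ≤ t n - t 0 := by
    have := hmono 0 n (by omega)
    rw [Nat.zero_add] at this
    linarith
  have hle : t n - t 0 ≤ T := by
    have := hmono n (N - n) (by omega)
    rw [Nat.add_sub_cancel' hn] at this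
    linarith
  gcongr
end

section
/- Let E be a real normed vector space, t₀ < t₁ < ⋯ < t_N a subdivision with step sizes h_n = t_{n+1} − t_n, h_max = max_n h_n, and T = t_N − t₀, and let φ : ℝ × E × ℝ → E satisfy ‖φ(t, x, h) − φ(t, y, h)‖ ≤ L‖x − y‖ for all t, h ∈ ℝ and x, y ∈ E (L > 0). Let x : [t₀, t₀ + T] → E be given, define the consistency errors e_n = (x(t_{n+1}) − x(t_n))/h_n − φ(t_n, x(t_n), h_n), and let (x_n) be the method iterates: x₀ = x(t₀) and x_{n+1} = x_n + h_n φ(t_n, x_n, h_n). Then max_{0 ≤ n ≤ N} ‖x(t_n) − x_n‖ ≤ e^{L T} · T · max_{0 ≤ n < N} ‖e_n‖. In particular, if max_n ‖e_n‖ ≤ C h_max^p for some C > 0 and integer p ≥ 1 (i.e. the method has order p), then max_n ‖x(t_n) − x_n‖ ≤ e^{L T} · T · C · h_max^p. -/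
/-- Convergence criterion for a one-step method with a uniformly L-Lipschitz
increment function: the global error is bounded by `exp (L * T) * T` times the
maximal consistency error; in particular an order-p consistency bound
`C * h_max ^ p` yields a global error bound `exp (L * T) * T * C * h_max ^ p`. -/
theorem convergence_criterion_one_step_method
    {E : Type*} [NormedAddCommGroup E] [NormedSpace ℝ E]
    (N : ℕ) (hN : 0 < N) (t : ℕ → ℝ)
    (ht : ∀ n < N, t n < t (n + 1))
    (h : ℕ → ℝ) (hh : ∀ n, h n = t (n + 1) - t n)
    (hmax : ℝ)
    (hhmax : hmax = (Finset.range N).sup' (Finset.nonempty_range_iff.mpr (by omega)) h)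
    (T : ℝ) (hT : T = t N - t 0)
    (φ : ℝ × E × ℝ → E) (L : ℝ) (hL : 0 < L)
    (hφ : ∀ (s hs : ℝ) (u v : E), ‖φ (s, u, hs) - φ (s, v, hs)‖ ≤ L * ‖u - v‖)
    (x : ℝ → E) (e : ℕ → E)
    (he : ∀ n < N, e n = (h n)⁻¹ • (x (t (n + 1)) - x (t n)) - φ (t n, x (t n), h n))
    (xs : ℕ → E) (hxs0 : xs 0 = x (t 0))
    (hxs : ∀ n < N, xs (n + 1) = xs n + h n • φ (t n, xs n, h n)) :
    (∀ n ≤ N, ‖x (t n) - xs n‖ ≤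
      Real.exp (L * T) * T *
        ((Finset.range N).sup' (Finset.nonempty_range_iff.mpr (by omega))
          fun n => ‖e n‖)) ∧
    (∀ (C : ℝ) (p : ℕ), 0 < C → 1 ≤ p →
      ((Finset.range N).sup' (Finset.nonempty_range_iff.mpr (by omega))
          (fun n => ‖e n‖) ≤ C * hmax ^ p) →
      ∀ n ≤ N, ‖x (t n) - xs n‖ ≤ Real.exp (L * T) * T * C * hmax ^ p) := by
  have hmono : ∀ m n, m ≤ n → n ≤ N → t m ≤ t n := by
    intro m n hmn
    induction n, hmn using Nat.le_induction with
    | base => intro _; exact le_rfl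
    | succ k hk ih => intro hkN; exact (ih (by omega)).trans (ht k (by omega)).le
  have key : ∀ M : ℝ, (∀ n < N, ‖e n‖ ≤ M) → ∀ n ≤ N,
      ‖x (t n) - xs n‖ ≤ Real.exp (L * (t n - t 0)) * (t n - t 0) * M := by
    intro M hM n
    have hM0 : 0 ≤ M := (norm_nonneg _).trans (hM 0 hN)
    induction n with
    | zero => intro _; simp [hxs0]
    | succ k ih =>
      intro hk
      have hkN : k < N := by omega
      have ih := ih hkN.le
      have hpos : 0 < h k := by rw [hh]; linarith [ht k hkN]
      have hs : 0 ≤ t k - t 0 := by linarith [hmono 0 k (Nat.zero_le _) hkN.le]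
      have hs1 : t (k + 1) - t 0 = (t k - t 0) + h k := by rw [hh]; ring
      have h1 : x (t (k + 1)) - xs (k + 1) = (x (t k) - xs k)
          + h k • (φ (t k, x (t k), h k) - φ (t k, xs k, h k)) + h k • e k := by
        rw [he k hkN, hxs k hkN, smul_sub, smul_sub, smul_inv_smul₀ hpos.ne']
        abel
      have h2 : ‖x (t (k + 1)) - xs (k + 1)‖ ≤
          ‖x (t k) - xs k‖ + h k * (L * ‖x (t k) - xs k‖) + h k * M := by
        rw [h1]
        refine (norm_add₃_le).trans ?_
        rw [norm_smul, norm_smul, Real.norm_of_nonneg hpos.le]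
        gcongr
        · exact hφ _ _ _ _
        · exact hM k hkN
      rw [hs1]
      generalize t k - t 0 = s at *
      have h3 : L * h k + 1 ≤ Real.exp (L * h k) := Real.add_one_le_exp _
      have h4 : (1 : ℝ) ≤ Real.exp (L * (s + h k)) := Real.one_le_exp (by positivity)
      have h5 : Real.exp (L * (s + h k)) = Real.exp (L * h k) * Real.exp (L * s) := by
        rw [← Real.exp_add]; ring_nf
      calc ‖x (t (k + 1)) - xs (k + 1)‖
          ≤ (L * h k + 1) * ‖x (t k) - xs k‖ + 1 * (h k * M) := by linarith
        _ ≤ Real.exp (L * h k) * (Real.exp (L * s) * s * M)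
            + Real.exp (L * (s + h k)) * (h k * M) := by gcongr
        _ = Real.exp (L * (s + h k)) * (s + h k) * M := by rw [h5]; ring
  have main : ∀ M : ℝ, (∀ n < N, ‖e n‖ ≤ M) → ∀ n ≤ N,
      ‖x (t n) - xs n‖ ≤ Real.exp (L * T) * T * M := by
    intro M hM n hn
    have hM0 : 0 ≤ M := (norm_nonneg _).trans (hM 0 hN)
    have a := hmono 0 n (Nat.zero_le _) hn
    have b := hmono n N hn le_rfl
    have c : t n - t 0 ≤ T := by linarith
    have d : 0 ≤ t n - t 0 := by linarith
    refine (key M hM n hn).trans ?_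
    gcongr
  refine ⟨main _ fun n hn => Finset.le_sup' (fun n => ‖e n‖) (Finset.mem_range.mpr hn), ?_⟩
  intro C p _ _ hC n hn
  rw [mul_assoc _ C]
  exact main _ (fun n hn =>
    (Finset.le_sup' (fun n => ‖e n‖) (Finset.mem_range.mpr hn)).trans hC) n hn
end
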